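/- Let g be a finite-dimensional simple Lie algebra over an algebraically closed field K of characteristic 0 and let φ : g → g be a local automorphism. If V is a nilpotent subspace of g, then φ(V) and φ⁻¹(V) are nilpotent subspaces of g; hence φ induces a permutation of the set of nilpotent subspaces of g, and in particular a permutation of the set of nilpotent subspaces of maximal dimension (dim g − rank g)/2. -/

import Mathlib

/-- A linear map `φ : L → L` is a *local automorphism* of the Lie algebra `L` if for
every `x ∈ L` there exists a Lie algebra automorphism `e` of `L` with `φ x = e x`. -/
def IsLocalAutomorphism (K L : Type*) [Field K] [LieRing L] [LieAlgebra K L]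
    (φ : L →ₗ[K] L) : Prop :=
  ∀ x : L, ∃ e : L ≃ₗ⁅K⁆ L, φ x = e x

/-- A subspace of a Lie algebra is *nilpotent* if all its elements are nilpotent,
i.e. have nilpotent adjoint action. -/
def IsNilpotentSubspace (K L : Type*) [Field K] [LieRing L] [LieAlgebra K L]
    (V : Submodule K L) : Prop :=
  ∀ x ∈ V, IsNilpotent (LieAlgebra.ad K L x)

section

variable {K L : Type*} [Field K] [LieRing L] [LieAlgebra K L]

theorem LieEquiv.isNilpotent_ad_apply_iff (e : L ≃ₗ⁅K⁆ L) (x : L) :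
    IsNilpotent (LieAlgebra.ad K L (e x)) ↔ IsNilpotent (LieAlgebra.ad K L x) := by
  rw [← LieAlgebra.conj_ad_apply e x]
  exact IsNilpotent.map_iff (f := e.toLinearEquiv.conjRingEquiv)
    e.toLinearEquiv.conjRingEquiv.injective

namespace IsLocalAutomorphism

variable {φ : L →ₗ[K] L}

theorem isNilpotent_ad_apply_iff (hφ : IsLocalAutomorphism K L φ) (x : L) :
    IsNilpotent (LieAlgebra.ad K L (φ x)) ↔ IsNilpotent (LieAlgebra.ad K L x) := by
  obtain ⟨e, he⟩ := hφ x
  rw [he, e.isNilpotent_ad_apply_iff]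

theorem injective (hφ : IsLocalAutomorphism K L φ) : Function.Injective φ := by
  rw [injective_iff_map_eq_zero]
  intro x hx
  obtain ⟨e, he⟩ := hφ x
  exact (map_eq_zero_iff e e.injective).mp (he ▸ hx)

theorem isNilpotentSubspace_map_iff (hφ : IsLocalAutomorphism K L φ) (V : Submodule K L) :
    IsNilpotentSubspace K L (V.map φ) ↔ IsNilpotentSubspace K L V := by
  simp only [IsNilpotentSubspace, Submodule.mem_map, forall_exists_index, and_imp,
    forall_apply_eq_imp_iff₂, hφ.isNilpotent_ad_apply_iff]

theorem isNilpotentSubspace_comap (hφ : IsLocalAutomorphism K L φ) {V : Submodule K L}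
    (hV : IsNilpotentSubspace K L V) : IsNilpotentSubspace K L (V.comap φ) :=
  fun x hx ↦ (hφ.isNilpotent_ad_apply_iff x).mp (hV (φ x) hx)

theorem finrank_map_eq (hφ : IsLocalAutomorphism K L φ) (V : Submodule K L) :
    Module.finrank K (V.map φ) = Module.finrank K V :=
  (Submodule.equivMapOfInjective φ hφ.injective V).finrank_eq.symm

theorem map_comap_eq [FiniteDimensional K L] (hφ : IsLocalAutomorphism K L φ)
    (V : Submodule K L) : (V.comap φ).map φ = V :=
  Submodule.map_comap_eq_of_surjective (LinearMap.injective_iff_surjective.mp hφ.injective) V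

end IsLocalAutomorphism

end


theorem localAutomorphism_permutes_nilpotent_subspaces
    (K L : Type*) [Field K] [IsAlgClosed K] [CharZero K]
    [LieRing L] [LieAlgebra K L] [FiniteDimensional K L] [LieAlgebra.IsSimple K L]
    (φ : L →ₗ[K] L) (hφ : IsLocalAutomorphism K L φ) :
    -- images and preimages of nilpotent subspaces are nilpotent subspaces
    (∀ V : Submodule K L, IsNilpotentSubspace K L V →
      IsNilpotentSubspace K L (V.map φ) ∧ IsNilpotentSubspace K L (V.comap φ)) ∧
    -- hence `V ↦ φ(V)` permutes the set of nilpotent subspaces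
    Set.BijOn (Submodule.map φ)
      {V : Submodule K L | IsNilpotentSubspace K L V}
      {V : Submodule K L | IsNilpotentSubspace K L V} ∧
    -- and in particular the set of nilpotent subspaces of maximal dimension
    -- `(dim L - rank L)/2`, where `rank L` is the dimension of a Cartan subalgebra
    (∀ H : LieSubalgebra K L, H.IsCartanSubalgebra →
      Set.BijOn (Submodule.map φ)
        {V : Submodule K L | IsNilpotentSubspace K L V ∧
          2 * Module.finrank K V + Module.finrank K H = Module.finrank K L}
        {V : Submodule K L | IsNilpotentSubspace K L V ∧
          2 * Module.finrank K V + Module.finrank K H = Module.finrank K L}) := by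
  refine ⟨fun V hV ↦ ⟨(hφ.isNilpotentSubspace_map_iff V).mpr hV,
    hφ.isNilpotentSubspace_comap hV⟩, ⟨?_, ?_, ?_⟩, fun H _ ↦ ⟨?_, ?_, ?_⟩⟩
  · exact fun V hV ↦ (hφ.isNilpotentSubspace_map_iff V).mpr hV
  · exact (Submodule.map_injective_of_injective hφ.injective).injOn
  · exact fun V hV ↦ ⟨V.comap φ, hφ.isNilpotentSubspace_comap hV, hφ.map_comap_eq V⟩
  · rintro V ⟨hV, hdim⟩
    exact ⟨(hφ.isNilpotentSubspace_map_iff V).mpr hV, by rwa [hφ.finrank_map_eq]⟩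
  · exact (Submodule.map_injective_of_injective hφ.injective).injOn
  · rintro V ⟨hV, hdim⟩
    refine ⟨V.comap φ, ⟨hφ.isNilpotentSubspace_comap hV, ?_⟩, hφ.map_comap_eq V⟩
    rwa [← hφ.finrank_map_eq, hφ.map_comap_eq]
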